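/- arXiv:1812.05352 — 2 statements merged into one kernel-verified Lean document; each statement's English description precedes it below -/
import Mathlib

section
/- Let R be a finite set (of robots), let I and J be finite index sets, and let (U_i)_{i∈I} and (U'_j)_{j∈J} be families of finite subsets of R such that: (i) the sets U_i are pairwise disjoint; (ii) for every j ∈ J there exist at least two distinct indices i ∈ I with U_i ∩ U'_j ≠ ∅; and (iii) for every i ∈ I there is at most one j ∈ J with U_i ∩ U'_j ≠ ∅. Then 2·|J| ≤ |I|. -/
/-- If every `j` is related to at least two distinct `i`, and every `i` is related to at most
one `j`, then there are at least twice as many `i` as `j`. -/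
theorem two_mul_card_le_card_of_rel {I J : Type*} [Fintype I] [Fintype J] (r : I → J → Prop)
    (two : ∀ j, ∃ i i', i ≠ i' ∧ r i j ∧ r i' j)
    (unique : ∀ i j j', r i j → r i j' → j = j') :
    2 * Fintype.card J ≤ Fintype.card I := by
  choose f g hne hf hg using two
  have hinj : Function.Injective (Sum.elim f g) := by
    refine Function.Injective.sumElim (fun j j' h => ?_) (fun j j' h => ?_) (fun j j' h => ?_)
    · exact unique (f j) j j' (hf j) (h ▸ hf j')
    · exact unique (g j) j j' (hg j) (h ▸ hg j')
    · obtain rfl : j = j' := unique (f j) j j' (hf j) (h ▸ hg j')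
      exact hne j h
  simpa [two_mul] using Fintype.card_le_of_injective _ hinj

/-- The combinatorial core of the halving lemma: if the finite sets `U i` are pairwise
disjoint, every `U' j` meets at least two distinct `U i`, and every `U i` meets at most
one `U' j`, then `2 * |J| ≤ |I|`. -/
theorem dispersion_halving_core
    {R I J : Type*} [Fintype R] [Fintype I] [Fintype J] [DecidableEq R]
    (U : I → Finset R) (U' : J → Finset R)
    (hdisj : ∀ i i' : I, i ≠ i' → Disjoint (U i) (U i'))
    (htwo : ∀ j : J, ∃ i i' : I, i ≠ i' ∧ (U i ∩ U' j).Nonempty ∧ (U i' ∩ U' j).Nonempty)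
    (hone : ∀ (i : I) (j j' : J), (U i ∩ U' j).Nonempty → (U i ∩ U' j').Nonempty → j = j') :
    2 * Fintype.card J ≤ Fintype.card I :=
  two_mul_card_le_card_of_rel (fun i j => (U i ∩ U' j).Nonempty) htwo hone
end

section
/- Let G be a connected simple graph on a finite nonempty vertex set of size n with m edges. Then there exists a closed walk in G whose length is at most 4m − 2n + 2, whose support contains every vertex of G, and whose edge list contains every edge of G. -/
namespace SimpleGraph

/-- A closed walk through `a` extends to one that also traverses the edge `s(a, b)` twice. -/
lemma Walk.exists_closed_walk_insert_edge {V : Type*} [DecidableEq V] {G : SimpleGraph V}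
    {v a b : V} (w : G.Walk v v) (ha : a ∈ w.support) (hab : G.Adj a b) :
    ∃ w' : G.Walk a a, w'.length = w.length + 2 ∧
      w'.edges.toFinset = insert s(a, b) w.edges.toFinset := by
  refine ⟨.cons hab (.cons hab.symm (w.rotate a ha)), ?_, ?_⟩
  · simp
  · ext e
    simp [Sym2.eq_swap (a := b), (w.rotate_edges a ha).mem_iff]

/-- In a connected graph, a closed walk that misses a vertex or an edge has in its support an
endpoint of an edge it misses. -/
lemma Connected.exists_adj_notMem_edges {V : Type*} {G : SimpleGraph V} (hG : G.Connected)
    {v : V} (w : G.Walk v v) (h : ¬((∀ u, u ∈ w.support) ∧ ∀ e ∈ G.edgeSet, e ∈ w.edges)) :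
    ∃ a b, a ∈ w.support ∧ G.Adj a b ∧ s(a, b) ∉ w.edges := by
  by_cases hs : ∀ u, u ∈ w.support
  · have he : ¬ ∀ e ∈ G.edgeSet, e ∈ w.edges := fun he => h ⟨hs, he⟩
    push Not at he
    obtain ⟨⟨a, b⟩, hab, hw⟩ := he
    exact ⟨a, b, hs a, hab, hw⟩
  · push Not at hs
    obtain ⟨u, hu⟩ := hs
    obtain ⟨p⟩ := hG.preconnected v u
    obtain ⟨d, -, hd₁, hd₂⟩ :=
      p.exists_boundary_dart {x | x ∈ w.support} w.start_mem_support hu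
    exact ⟨d.fst, d.snd, hd₁, d.adj, fun hw => hd₂ (w.snd_mem_support_of_mem_edges hw)⟩

/-- A finite connected graph has a closed walk covering all vertices and edges whose length is at
most twice the number of edges. -/
lemma Connected.exists_closed_walk_length_le {V : Type*} {G : SimpleGraph V}
    [Fintype G.edgeSet] (hG : G.Connected) :
    ∃ (v : V) (w : G.Walk v v), w.length ≤ 2 * G.edgeFinset.card ∧
      (∀ u, u ∈ w.support) ∧ ∀ e ∈ G.edgeSet, e ∈ w.edges := by
  classical
  have card_le {v : V} (w : G.Walk v v) : w.edges.toFinset.card ≤ G.edgeFinset.card :=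
    Finset.card_le_card fun e he =>
      mem_edgeFinset.2 (w.edges_subset_edgeSet (List.mem_toFinset.1 he))
  by_contra! hcon
  have walks (k : ℕ) : ∃ (v : V) (w : G.Walk v v),
      w.length = 2 * k ∧ w.edges.toFinset.card = k := by
    induction k with
    | zero => exact ⟨hG.nonempty.some, .nil, rfl, rfl⟩
    | succ k ih =>
      obtain ⟨v, w, hlen, hcard⟩ := ih
      have hmiss : ¬((∀ u, u ∈ w.support) ∧ ∀ e ∈ G.edgeSet, e ∈ w.edges) := by
        rintro ⟨hs, he⟩
        obtain ⟨e, heG, hew⟩ := hcon v w (by have := card_le w; lia) hs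
        exact hew (he e heG)
      obtain ⟨a, b, ha, hab, hw⟩ := hG.exists_adj_notMem_edges w hmiss
      obtain ⟨w', hlen', hedges⟩ := w.exists_closed_walk_insert_edge ha hab
      refine ⟨a, w', by lia, ?_⟩
      rw [hedges, Finset.card_insert_of_notMem (by simpa using hw), hcard]
  obtain ⟨v, w, -, hcard⟩ := walks (G.edgeFinset.card + 1)
  have := card_le w
  lia

end SimpleGraph

/-- In a connected graph on `n` vertices with `m` edges, there is a closed walk of
length at most `4m − 2n + 2` visiting every vertex and traversing every edge. -/
theorem exists_closed_walk_covering_all_edges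
    {V : Type*} [Fintype V] [Nonempty V]
    (G : SimpleGraph V) [Fintype G.edgeSet] (hG : G.Connected) :
    ∃ (v : V) (w : G.Walk v v),
      (w.length : ℤ) ≤ 4 * G.edgeFinset.card - 2 * Fintype.card V + 2 ∧
      (∀ u : V, u ∈ w.support) ∧
      ∀ e ∈ G.edgeSet, e ∈ w.edges := by
  obtain ⟨v, w, hlen, hw⟩ := hG.exists_closed_walk_length_le
  refine ⟨v, w, ?_, hw⟩
  have hcard := hG.card_vert_le_card_edgeSet_add_one
  rw [Nat.card_eq_fintype_card, Nat.card_eq_fintype_card, ← SimpleGraph.edgeFinset_card] at hcard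
  lia
end
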